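/- For every c > 0, ∫_{−∞}^{∞} z²(c + z²)^{−2} e^{−z²/2} dz = (π(1+c) e^{c/2} / (2√c)) erfc(√(c/2)) − √(π/2), where erfc(x) = (2/√π)∫_x^∞ e^{−r²} dr. -/

import Mathlib

open Real MeasureTheory

noncomputable def erfc (x : ℝ) : ℝ :=
  (2 / Real.sqrt π) * ∫ r in Set.Ioi x, Real.exp (-r ^ 2)

lemma aux_exp_int : Integrable (fun z : ℝ => Real.exp (-z ^ 2 / 2)) := by
  have h := integrable_exp_neg_mul_sq (b := 1 / 2) (by norm_num)
  refine h.congr (Filter.Eventually.of_forall fun z => ?_)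
  simp only
  congr 1
  ring

lemma aux_exp_val : ∫ z : ℝ, Real.exp (-z ^ 2 / 2) = 2 * Real.sqrt (π / 2) := by
  have h := integral_gaussian (1 / 2)
  have e : (fun z : ℝ => Real.exp (-z ^ 2 / 2)) = fun z : ℝ => Real.exp (-(1 / 2) * z ^ 2) := by
    funext z
    congr 1
    ring
  rw [e, h]
  have : π / (1 / 2) = 2 ^ 2 * (π / 2) := by ring
  rw [this, Real.sqrt_mul (by norm_num), Real.sqrt_sq (by norm_num)]

lemma aux_A_int (c : ℝ) (hc : 0 < c) :
    Integrable (fun z : ℝ => Real.exp (-z ^ 2 / 2) / (c + z ^ 2)) := by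
  refine (aux_exp_int.const_mul (1 / c)).mono' ?_ (Filter.Eventually.of_forall fun z => ?_)
  · apply Measurable.aestronglyMeasurable
    fun_prop
  · have h1 : c ≤ c + z ^ 2 := by nlinarith [sq_nonneg z]
    rw [Real.norm_of_nonneg (by positivity), div_eq_mul_one_div, mul_comm]
    gcongr

lemma aux_B_int (c : ℝ) (hc : 0 < c) :
    Integrable (fun z : ℝ => z ^ 2 * Real.exp (-z ^ 2 / 2) / (c + z ^ 2) ^ 2) := by
  refine (aux_A_int c hc).mono' ?_ (Filter.Eventually.of_forall fun z => ?_)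
  · apply Measurable.aestronglyMeasurable
    fun_prop
  · have h1 : 0 < c + z ^ 2 := by positivity
    rw [Real.norm_of_nonneg (by positivity), div_le_div_iff₀ (by positivity) h1]
    have h2 : z ^ 2 ≤ c + z ^ 2 := by linarith
    have h3 : 0 ≤ Real.exp (-z ^ 2 / 2) * (c + z ^ 2) := by positivity
    nlinarith [mul_le_mul_of_nonneg_left h2 h3]

lemma aux_F_int (c : ℝ) (hc : 0 < c) :
    Integrable (fun z : ℝ => z / (c + z ^ 2) * Real.exp (-z ^ 2 / 2)) := by
  have h := (integrable_mul_exp_neg_mul_sq (b := 1 / 2) (by norm_num)).norm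
  refine (h.const_mul (1 / c)).mono' ?_ (Filter.Eventually.of_forall fun z => ?_)
  · apply Measurable.aestronglyMeasurable
    fun_prop
  · have h1 : c ≤ c + z ^ 2 := by nlinarith [sq_nonneg z]
    have e : -(1 / 2) * z ^ 2 = -z ^ 2 / 2 := by ring
    have e2 : z / (c + z ^ 2) * Real.exp (-z ^ 2 / 2)
        = 1 / (c + z ^ 2) * (z * Real.exp (-z ^ 2 / 2)) := by ring
    rw [e, e2, norm_mul, Real.norm_of_nonneg (r := 1 / (c + z ^ 2)) (by positivity)]
    gcongr

lemma aux_ibp (c : ℝ) (hc : 0 < c) :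
    (1 + c) * (∫ z : ℝ, Real.exp (-z ^ 2 / 2) / (c + z ^ 2))
      - 2 * (∫ z : ℝ, z ^ 2 * Real.exp (-z ^ 2 / 2) / (c + z ^ 2) ^ 2)
      - ∫ z : ℝ, Real.exp (-z ^ 2 / 2) = 0 := by
  have hA := (aux_A_int c hc).const_mul (1 + c)
  have hB := (aux_B_int c hc).const_mul 2
  rw [← integral_const_mul, ← integral_const_mul, ← integral_sub' hA hB,
    ← integral_sub' (hA.sub hB) aux_exp_int]
  refine integral_eq_zero_of_hasDerivAt_of_integrable (fun z => ?_)
    ((hA.sub hB).sub aux_exp_int) (aux_F_int c hc)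
  have h1 : c + z ^ 2 ≠ 0 := by positivity
  have d1 : HasDerivAt (fun z : ℝ => c + z ^ 2) (2 * z) z := by
    simpa using (hasDerivAt_pow 2 z).const_add c
  have d2 : HasDerivAt (fun z : ℝ => -z ^ 2 / 2) (-(2 * z) / 2) z := by
    simpa using ((hasDerivAt_pow 2 z).neg.div_const 2)
  refine (((hasDerivAt_id' z).div d1 h1).mul d2.exp).congr_deriv ?_
  simp only [Pi.sub_apply, Pi.div_apply]
  field_simp
  ring

lemma aux_inner_r (c : ℝ) (hc : 0 < c) (z : ℝ) :
    ∫ r in Set.Ioi (Real.sqrt (c / 2)), 2 * r / c * Real.exp (-(1 + z ^ 2 / c) * r ^ 2)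
      = Real.exp (-(c / 2)) * (Real.exp (-z ^ 2 / 2) / (c + z ^ 2)) := by
  have hk : 0 < 1 + z ^ 2 / c := by positivity
  have h1 : 0 < c + z ^ 2 := by positivity
  have hd : ∀ r : ℝ, HasDerivAt
      (fun r => -(Real.exp (-(1 + z ^ 2 / c) * r ^ 2) / (c + z ^ 2)))
      (2 * r / c * Real.exp (-(1 + z ^ 2 / c) * r ^ 2)) r := by
    intro r
    have d2 : HasDerivAt (fun r : ℝ => -(1 + z ^ 2 / c) * r ^ 2)
        (-(1 + z ^ 2 / c) * (2 * r)) r := by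
      refine ((hasDerivAt_pow 2 r).const_mul (-(1 + z ^ 2 / c))).congr_deriv ?_
      simp
    refine (d2.exp.div_const (c + z ^ 2)).neg.congr_deriv ?_
    field_simp
  have ht : Filter.Tendsto (fun r : ℝ => -(Real.exp (-(1 + z ^ 2 / c) * r ^ 2) / (c + z ^ 2)))
      Filter.atTop (nhds 0) := by
    have t1 : Filter.Tendsto (fun r : ℝ => -(1 + z ^ 2 / c) * r ^ 2)
        Filter.atTop Filter.atBot :=
      (Filter.tendsto_pow_atTop (by norm_num)).const_mul_atTop_of_neg (by linarith)
    simpa using ((Real.tendsto_exp_atBot.comp t1).div_const (c + z ^ 2)).neg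
  rw [integral_Ioi_of_hasDerivAt_of_nonneg' (fun r _ => hd r) (fun r hr => ?_) ht]
  · rw [Real.sq_sqrt (by positivity)]
    have : -(1 + z ^ 2 / c) * (c / 2) = -(c / 2) + -z ^ 2 / 2 := by field_simp; ring
    rw [this, Real.exp_add]
    ring
  · have : 0 < r := lt_of_le_of_lt (Real.sqrt_nonneg _) hr
    positivity

lemma aux_inner_z (c : ℝ) (hc : 0 < c) (r : ℝ) (hr : 0 < r) :
    ∫ z : ℝ, 2 * r / c * Real.exp (-(1 + z ^ 2 / c) * r ^ 2)
      = 2 * Real.sqrt π / Real.sqrt c * Real.exp (-r ^ 2) := by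
  have e : (fun z : ℝ => 2 * r / c * Real.exp (-(1 + z ^ 2 / c) * r ^ 2))
      = fun z => (2 * r / c * Real.exp (-r ^ 2)) * Real.exp (-(r ^ 2 / c) * z ^ 2) := by
    funext z
    rw [mul_assoc, ← Real.exp_add]
    congr 2
    ring
  rw [e, integral_const_mul, integral_gaussian]
  have : π / (r ^ 2 / c) = π * c / r ^ 2 := by field_simp
  rw [this, Real.sqrt_div (by positivity), Real.sqrt_sq hr.le, Real.sqrt_mul pi_pos.le]
  have hs : 0 < Real.sqrt c := Real.sqrt_pos.2 hc
  have hs2 : Real.sqrt c ^ 2 = c := Real.sq_sqrt hc.le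
  field_simp
  rw [hs2]
  try ring

lemma aux_prod_int (c : ℝ) (hc : 0 < c) :
    Integrable (fun p : ℝ × ℝ => 2 * p.2 / c * Real.exp (-(1 + p.1 ^ 2 / c) * p.2 ^ 2))
      ((volume : Measure ℝ).prod (volume.restrict (Set.Ioi (Real.sqrt (c / 2))))) := by
  rw [integrable_prod_iff' (by apply Measurable.aestronglyMeasurable; fun_prop)]
  have hpos : ∀ r ∈ Set.Ioi (Real.sqrt (c / 2)), 0 < r :=
    fun r hr => lt_of_le_of_lt (Real.sqrt_nonneg _) hr
  constructor
  · refine (ae_restrict_mem measurableSet_Ioi).mono fun r hr => ?_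
    have h0 := hpos r hr
    have h := (integrable_exp_neg_mul_sq (b := r ^ 2 / c) (by positivity)).const_mul
      (2 * r / c * Real.exp (-r ^ 2))
    refine h.congr (Filter.Eventually.of_forall fun z => ?_)
    simp only
    rw [mul_assoc, ← Real.exp_add]
    congr 2
    ring
  · have h := ((integrable_exp_neg_mul_sq (b := 1) one_pos).const_mul
      (2 * Real.sqrt π / Real.sqrt c)).restrict (s := Set.Ioi (Real.sqrt (c / 2)))
    refine h.congr ((ae_restrict_mem measurableSet_Ioi).mono fun r hr => ?_)
    have h0 := hpos r hr
    have := aux_inner_z c hc r h0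
    simp only [neg_one_mul]
    rw [← this]
    congr 1
    funext z
    rw [Real.norm_of_nonneg (by positivity)]

lemma aux_A (c : ℝ) (hc : 0 < c) :
    ∫ z : ℝ, Real.exp (-z ^ 2 / 2) / (c + z ^ 2)
      = π / Real.sqrt c * Real.exp (c / 2) * erfc (Real.sqrt (c / 2)) := by
  have h := integral_integral_swap
    (f := fun z r : ℝ => 2 * r / c * Real.exp (-(1 + z ^ 2 / c) * r ^ 2)) (aux_prod_int c hc)
  simp only [aux_inner_r c hc] at h
  rw [integral_const_mul, setIntegral_congr_fun measurableSet_Ioi (fun r hr =>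
    aux_inner_z c hc r (lt_of_le_of_lt (Real.sqrt_nonneg _) hr)), integral_const_mul] at h
  have h2 : Real.exp (c / 2) * Real.exp (-(c / 2)) = 1 := by rw [← Real.exp_add]; simp
  rw [← one_mul (∫ z : ℝ, Real.exp (-z ^ 2 / 2) / (c + z ^ 2)), ← h2, mul_assoc, h, erfc]
  have hs : 0 < Real.sqrt c := Real.sqrt_pos.2 hc
  have hs2 : Real.sqrt π ^ 2 = π := Real.sq_sqrt pi_pos.le
  have hs3 : 0 < Real.sqrt π := Real.sqrt_pos.2 pi_pos
  field_simp
  rw [hs2]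
  try ring

theorem stmt_11 (c : ℝ) (hc : 0 < c) :
    ∫ z : ℝ, z ^ 2 * Real.exp (-z ^ 2 / 2) / (c + z ^ 2) ^ 2 =
      (π * (1 + c) * Real.exp (c / 2) / (2 * Real.sqrt c)) *
          erfc (Real.sqrt (c / 2)) - Real.sqrt (π / 2) := by
  have h := aux_ibp c hc
  rw [aux_exp_val, aux_A c hc] at h
  have e : (π * (1 + c) * Real.exp (c / 2) / (2 * Real.sqrt c)) * erfc (Real.sqrt (c / 2))
      = (1 + c) * (π / Real.sqrt c * Real.exp (c / 2) * erfc (Real.sqrt (c / 2))) / 2 := by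
    have hs : 0 < Real.sqrt c := Real.sqrt_pos.2 hc
    field_simp
  rw [e]
  linarith
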